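/- Let 𝔞 be a Lie algebra over a field k of characteristic zero, U𝔞 its universal enveloping algebra with canonical map ι : 𝔞 → U𝔞. For p ≥ 1 let Sym^p(𝔞) ⊆ U𝔞 denote the k-linear span of the symmetrized products Σ_{σ ∈ S_p} ι(x_{σ(1)})ι(x_{σ(2)})⋯ι(x_{σ(p)}) over all x₁,…,x_p ∈ 𝔞, and let [𝔞, Sym^p(𝔞)] ⊆ Sym^p(𝔞) denote the span of the elements ι(x)s − sι(x) with x ∈ 𝔞, s ∈ Sym^p(𝔞). Then the maps induced by the inclusions Sym^p(𝔞) ⊆ U𝔞 assemble to a k-linear isomorphism ⊕_{p≥1} Sym^p(𝔞)/[𝔞, Sym^p(𝔞)] ≅ U𝔞/(k·1 + [U𝔞, U𝔞]), where [U𝔞, U𝔞] is the k-span of all commutators uv − vu with u, v ∈ U𝔞. -/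

import Mathlib

noncomputable section

variable (k : Type*) [Field k] [CharZero k] (L : Type*) [LieRing L] [LieAlgebra k L]

/-- `Sym^p(𝔞) ⊆ U𝔞`: the `k`-linear span of the symmetrized products
`Σ_{σ ∈ S_p} ι(x_{σ(1)}) ⋯ ι(x_{σ(p)})` over all `x₁,…,x_p ∈ 𝔞`. -/
def symU (p : ℕ) : Submodule k (UniversalEnvelopingAlgebra k L) :=
  Submodule.span k
    { x | ∃ v : Fin p → L,
        x = ∑ σ : Equiv.Perm (Fin p),
              (List.ofFn fun i => UniversalEnvelopingAlgebra.ι k (v (σ i))).prod }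

/-- `[𝔞, Sym^p(𝔞)]`, viewed as a subspace of `Sym^p(𝔞)`: the span of the elements of
`Sym^p(𝔞)` of the form `ι(x)·s − s·ι(x)` with `x ∈ 𝔞`, `s ∈ Sym^p(𝔞)`. -/
def commSym (p : ℕ) : Submodule k ↥(symU k L p) :=
  Submodule.span k
    { s | ∃ (x : L) (t : ↥(symU k L p)),
        (s : UniversalEnvelopingAlgebra k L) =
          UniversalEnvelopingAlgebra.ι k x * (t : UniversalEnvelopingAlgebra k L) -
            (t : UniversalEnvelopingAlgebra k L) * UniversalEnvelopingAlgebra.ι k x }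

/-- The subspace `k·1 + [U𝔞, U𝔞]` of `U𝔞`, where `[U𝔞, U𝔞]` is the `k`-span of all
commutators `uv − vu`. -/
def cyclicSub : Submodule k (UniversalEnvelopingAlgebra k L) :=
  Submodule.span k
    ({1} ∪ { z | ∃ u v : UniversalEnvelopingAlgebra k L, z = u * v - v * u })

/-- The `k`-linear map `Sym^p(𝔞)/[𝔞, Sym^p(𝔞)] → U𝔞/(k·1 + [U𝔞, U𝔞])` induced by the
inclusion `Sym^p(𝔞) ⊆ U𝔞`. -/
def toCyclic (p : ℕ) :
    (↥(symU k L p) ⧸ commSym k L p) →ₗ[k]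
      (UniversalEnvelopingAlgebra k L ⧸ cyclicSub k L) :=
  Submodule.liftQ _ ((cyclicSub k L).mkQ.comp (symU k L p).subtype) (by
    refine Submodule.span_le.mpr ?_
    rintro s ⟨x, t, hs⟩
    have h1 : ((s : UniversalEnvelopingAlgebra k L)) ∈ cyclicSub k L :=
      Submodule.subset_span (Or.inr ⟨_, _, hs⟩)
    simpa [LinearMap.mem_ker, Submodule.Quotient.mk_eq_zero] using h1)

namespace CycAux

set_option linter.unusedSectionVars false

attribute [local instance 100] LieRing.ofAssociativeRing

open UniversalEnvelopingAlgebra TensorProduct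

local notation "UU" => UniversalEnvelopingAlgebra k L

theorem ind (P : UU → Prop) (hc : ∀ r : k, P (algebraMap k _ r)) (hι : ∀ x : L, P (ι k x))
    (hm : ∀ a b, P a → P b → P (a * b)) (ha : ∀ a b, P a → P b → P (a + b)) (u : UU) : P u := by
  have hs : Function.Surjective (mkAlgHom k L) := by
    intro y
    exact Quotient.inductionOn' y fun a => ⟨a, rfl⟩
  obtain ⟨t, rfl⟩ := hs u
  induction t using TensorAlgebra.induction with
  | algebraMap r => rw [AlgHom.commutes]; exact hc r
  | ι x => exact hι x
  | mul a b h1 h2 => rw [map_mul]; exact hm _ _ h1 h2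
  | add a b h1 h2 => rw [map_add]; exact ha _ _ h1 h2

theorem ι_lie (x y : L) : ι k ⁅x, y⁆ = ι k x * ι k y - ι k y * ι k x := by
  rw [LieHom.map_lie, LieRing.of_associative_ring_bracket]

/-- comultiplication -/
def comul : UU →ₐ[k] (UU ⊗[k] UU) :=
  lift k
    { toFun := fun x => ι k x ⊗ₜ[k] 1 + 1 ⊗ₜ[k] ι k x
      map_add' := by intro x y; simp only [map_add, add_tmul, tmul_add]; abel
      map_smul' := by
        intro c x
        simp only [map_smul, smul_tmul', tmul_smul, smul_add, RingHom.id_apply]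
      map_lie' := by
        intro x y
        simp only [LieRing.of_associative_ring_bracket, ι_lie, sub_tmul, tmul_sub, mul_add, add_mul,
          Algebra.TensorProduct.tmul_mul_tmul, mul_one, one_mul]
        abel }

theorem comul_ι (x : L) : comul k L (ι k x) = ι k x ⊗ₜ[k] 1 + 1 ⊗ₜ[k] ι k x :=
  lift_ι_apply k _ x

/-- Adams operation -/
def psi : Module.End k UU := (LinearMap.mul' k UU).comp (comul k L).toLinearMap

theorem psi_pow (x : L) (p : ℕ) : psi k L (ι k x ^ p) = (2 ^ p : k) • (ι k x ^ p) := by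
  have hc : Commute (ι k x ⊗ₜ[k] (1 : UU)) ((1 : UU) ⊗ₜ[k] ι k x) := by
    simp [Commute, SemiconjBy]
  simp only [psi, LinearMap.comp_apply, AlgHom.toLinearMap_apply, map_pow, comul_ι]
  rw [hc.add_pow, map_sum]
  have : ∀ m ∈ Finset.range (p + 1), LinearMap.mul' k UU
      ((ι k x ⊗ₜ[k] (1 : UU)) ^ m * ((1 : UU) ⊗ₜ[k] ι k x) ^ (p - m) * ((p.choose m : ℕ) : UU ⊗[k] UU))
      = ((p.choose m : ℕ) : k) • (ι k x) ^ p := by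
    intro m hm
    rw [← nsmul_eq_mul', map_nsmul]
    simp only [Algebra.TensorProduct.tmul_pow, Algebra.TensorProduct.tmul_mul_tmul, one_pow, one_mul,
      mul_one, LinearMap.mul'_apply, ← pow_add]
    rw [Nat.add_sub_cancel' (by simpa [Nat.lt_succ_iff] using hm), Nat.cast_smul_eq_nsmul]
  rw [Finset.sum_congr rfl this, ← Finset.sum_smul, ← Nat.cast_sum, Nat.sum_range_choose]
  simp

theorem psi_comm (x : L) (u : UU) :
    psi k L (ι k x * u - u * ι k x) = ι k x * psi k L u - psi k L u * ι k x := by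
  simp only [psi, LinearMap.comp_apply, AlgHom.toLinearMap_apply, map_sub, map_mul, comul_ι]
  induction comul k L u using TensorProduct.induction_on with
  | zero => simp
  | tmul a b =>
    simp only [add_mul, mul_add, map_add, Algebra.TensorProduct.tmul_mul_tmul, LinearMap.mul'_apply,
      one_mul, mul_one, mul_assoc]
    abel
  | add a b h1 h2 =>
    simp only [mul_add, add_mul, map_add] at h1 h2 ⊢
    have h := congrArg₂ (· + ·) h1 h2
    convert h using 1
    · abel
    · abel

theorem polar {A : Type*} [Ring A] [Algebra k A] (p : ℕ) (a : Fin p → A) :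
    ∑ T : Finset (Fin p), ((-1) ^ T.card : ℤ) • (∑ i ∈ Tᶜ, a i) ^ p =
      ∑ σ : Equiv.Perm (Fin p), (List.ofFn fun i => a (σ i)).prod := by
  have h1 : ∀ T : Finset (Fin p), (∑ i ∈ Tᶜ, a i) ^ p =
      ∑ f : Fin p → Fin p, if T ⊆ (Finset.univ.image f)ᶜ then (List.ofFn fun i => a (f i)).prod else 0 := by
    intro T
    have := (MultilinearMap.mkPiAlgebraFin k p A).map_sum_finset (fun _ j => a j) (fun _ => Tᶜ)
    simp only [MultilinearMap.mkPiAlgebraFin_apply, List.ofFn_const, List.prod_replicate] at this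
    rw [this, ← Finset.sum_filter]
    refine Finset.sum_congr ?_ fun _ _ => rfl
    ext f
    simp only [Fintype.mem_piFinset, Finset.mem_compl, Finset.mem_filter, Finset.mem_univ, true_and,
      Finset.subset_iff, Finset.mem_image, not_exists]
    grind
  simp only [h1, Finset.smul_sum, smul_ite, smul_zero]
  rw [Finset.sum_comm]
  have h2 : ∀ f : Fin p → Fin p, (∑ T : Finset (Fin p), if T ⊆ (Finset.univ.image f)ᶜ then
      ((-1) ^ T.card : ℤ) • (List.ofFn fun i => a (f i)).prod else 0) =
      if Function.Bijective f then (List.ofFn fun i => a (f i)).prod else 0 := by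
    intro f
    rw [← Finset.sum_filter]
    have : Finset.univ.filter (fun T => T ⊆ (Finset.univ.image f)ᶜ) =
      (Finset.univ.image f)ᶜ.powerset := by ext; simp
    rw [this, ← Finset.sum_smul, Finset.sum_powerset_neg_one_pow_card]
    have : (Finset.univ.image f)ᶜ = ∅ ↔ Function.Bijective f := by
      rw [Finset.compl_eq_empty_iff, ← Finite.surjective_iff_bijective, ← Finset.coe_eq_univ, Finset.coe_image, Finset.coe_univ, Set.image_univ, Set.range_eq_univ]
    simp [this]
  simp only [h2]
  rw [← Finset.sum_filter]
  symm
  refine Finset.sum_bij (fun σ _ => ⇑σ) ?_ ?_ ?_ ?_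
  · intro σ _; exact Finset.mem_filter.mpr ⟨Finset.mem_univ _, σ.bijective⟩
  · intro σ _ τ _ h; exact Equiv.ext (congrFun h)
  · intro f hf
    exact ⟨Equiv.ofBijective f (Finset.mem_filter.mp hf).2, Finset.mem_univ _, rfl⟩
  · intro _ _; rfl

theorem symU_le (p : ℕ) (N : Submodule k UU) (h : ∀ x : L, ι k x ^ p ∈ N) : symU k L p ≤ N := by
  refine Submodule.span_le.mpr ?_
  rintro _ ⟨v, rfl⟩
  rw [← polar k p (fun i => ι k (v i))]
  refine Submodule.sum_mem _ fun T _ => ?_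
  rw [← map_sum, ← Int.cast_smul_eq_zsmul k]
  exact N.smul_mem _ (h _)

theorem symU_le_eig (p : ℕ) : symU k L p ≤ (psi k L).eigenspace (2 ^ p) :=
  symU_le k L p _ fun x => by rw [Module.End.mem_eigenspace_iff]; exact psi_pow k L x p

theorem two_inj : Function.Injective (fun p : ℕ => (2 ^ p : k)) := by
  intro p q h
  have : ((2 ^ p : ℕ) : k) = ((2 ^ q : ℕ) : k) := by simpa using h
  exact Nat.pow_right_injective le_rfl (Nat.cast_injective this)

theorem eig_indep : iSupIndep fun p : ℕ => (psi k L).eigenspace (2 ^ p : k) :=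
  (psi k L).eigenspaces_iSupIndep.comp (two_inj k)

/-- span of short products -/
def V (n : ℕ) : Submodule k UU :=
  Submodule.span k {u | ∃ l : List L, l.length < n ∧ u = (l.map (ι k)).prod}

theorem V_mul (x : L) (n : ℕ) (u : UU) (hu : u ∈ V k L n) : ι k x * u ∈ V k L (n + 1) := by
  have : V k L n ≤ (V k L (n + 1)).comap (LinearMap.mulLeft k (ι k x)) := by
    refine Submodule.span_le.mpr ?_
    rintro _ ⟨l, hl, rfl⟩
    exact Submodule.subset_span ⟨x :: l, by simpa using hl, by simp⟩
  exact this hu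

theorem perm_V {l l' : List L} (h : l.Perm l') :
    (l.map (ι k)).prod - (l'.map (ι k)).prod ∈ V k L l.length := by
  induction h with
  | nil => simp
  | cons x h ih =>
    simp only [List.map_cons, List.prod_cons, ← mul_sub, List.length_cons]
    exact V_mul k L x _ _ ih
  | swap x y l =>
    refine Submodule.subset_span ⟨⁅y, x⁆ :: l, by simp, ?_⟩
    simp only [List.map_cons, List.prod_cons, ι_lie]
    noncomm_ring
  | trans h1 h2 ih1 ih2 =>
    rw [← h1.length_eq] at ih2
    simpa using add_mem ih1 ih2

theorem V_le (n : ℕ) : V k L n ≤ ⨆ p, symU k L p := by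
  induction n with
  | zero => 
    refine Submodule.span_le.mpr ?_
    rintro _ ⟨l, hl, rfl⟩
    simp at hl
  | succ n ih =>
    refine Submodule.span_le.mpr ?_
    rintro _ ⟨l, hl, rfl⟩
    rcases Nat.lt_succ_iff_lt_or_eq.mp hl with h | h
    · exact ih (Submodule.subset_span ⟨l, h, rfl⟩)
    subst h
    set S : UU := ∑ σ : Equiv.Perm (Fin l.length), (List.ofFn fun i => ι k (l.get (σ i))).prod
    have hS : S ∈ ⨆ p, symU k L p :=
      (le_iSup (symU k L) l.length) (Submodule.subset_span ⟨l.get, rfl⟩)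
    have hd : ∑ σ : Equiv.Perm (Fin l.length), ((l.map (ι k)).prod -
        (List.ofFn fun i => ι k (l.get (σ i))).prod) ∈ ⨆ p, symU k L p := by
      refine Submodule.sum_mem _ fun σ _ => ih ?_
      have hp : (List.ofFn fun i => l.get (σ i)).Perm l := by
        have := Equiv.Perm.ofFn_comp_perm σ l.get
        rwa [List.ofFn_get] at this
      have := perm_V k L hp.symm
      rwa [List.map_ofFn] at this
    rw [Finset.sum_sub_distrib] at hd
    have := add_mem hd hS
    rw [sub_add_cancel, Finset.sum_const, Finset.card_univ, Fintype.card_perm, Fintype.card_fin,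
      ← Nat.cast_smul_eq_nsmul k] at this
    exact (Submodule.smul_mem_iff _ (Nat.cast_ne_zero.mpr (Nat.factorial_ne_zero _))).mp this

theorem iSup_top : ⨆ p, symU k L p = ⊤ := by
  rw [eq_top_iff]
  rintro u -
  have key : ∀ u : UU, u ∈ Submodule.span k {u | ∃ l : List L, u = (l.map (ι k)).prod} := by
    apply ind
    · intro r
      rw [Algebra.algebraMap_eq_smul_one]
      exact Submodule.smul_mem _ _ (Submodule.subset_span ⟨[], by simp⟩)
    · intro x
      exact Submodule.subset_span ⟨[x], by simp⟩
    · intro a b ha hb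
      have := Submodule.mul_mem_mul ha hb
      rw [Submodule.span_mul_span] at this
      refine Submodule.span_mono ?_ this
      rintro _ ⟨_, ⟨l, rfl⟩, _, ⟨m, rfl⟩, rfl⟩
      exact ⟨l ++ m, by simp⟩
    · intro a b ha hb
      exact add_mem ha hb
  refine (Submodule.span_le.mpr ?_) (key u)
  rintro _ ⟨l, rfl⟩
  exact V_le k L (l.length + 1) (Submodule.subset_span ⟨l, by simp, rfl⟩)

theorem internal : DirectSum.IsInternal (symU k L) :=
  DirectSum.isInternal_submodule_of_iSupIndep_of_iSup_eq_top
    ((eig_indep k L).mono (symU_le_eig k L)) (iSup_top k L)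

theorem internal' : Function.Bijective (DirectSum.coeLinearMap (symU k L)) := internal k L

theorem symU_eq (p : ℕ) : symU k L p = (psi k L).eigenspace (2 ^ p) := by
  have hint := internal k L
  refine le_antisymm (symU_le_eig k L p) fun u hu => ?_
  have hu' : u ∈ symU k L p ⊔ ⨆ q ≠ p, symU k L q := by
    have h := iSup_top k L
    rw [iSup_split_single (symU k L) p] at h
    rw [h]; trivial
  obtain ⟨s, hs, t, ht, rfl⟩ := Submodule.mem_sup.mp hu'
  have ht1 : t ∈ (psi k L).eigenspace (2 ^ p) := by
    simpa using sub_mem hu (symU_le_eig k L p hs)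
  have ht2 : t ∈ ⨆ q ≠ p, (psi k L).eigenspace (2 ^ q : k) :=
    iSup₂_mono (fun q _ => symU_le_eig k L q) ht
  have : t = 0 := Submodule.disjoint_def.mp (eig_indep k L p) t ht1 ht2
  simpa [this] using hs

theorem ad_mem (p : ℕ) (x : L) (s : UU) (hs : s ∈ symU k L p) :
    ι k x * s - s * ι k x ∈ symU k L p := by
  rw [symU_eq, Module.End.mem_eigenspace_iff] at hs ⊢
  rw [psi_comm, hs, smul_sub, mul_smul_comm, smul_mul_assoc]

theorem comm_mem (N : Submodule k UU) (h : ∀ (x : L) (u : UU), ι k x * u - u * ι k x ∈ N) (u v : UU) :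
    u * v - v * u ∈ N := by
  revert v
  revert u
  apply ind
  · intro r v
    rw [Algebra.commutes, sub_self]; exact zero_mem _
  · exact h
  · intro a b ha hb v
    have := add_mem (ha (b * v)) (hb (v * a))
    convert this using 1
    noncomm_ring
  · intro a b ha hb v
    have := add_mem (ha v) (hb v)
    convert this using 1
    noncomm_ring

/-- projection to the p-th component -/
def proj (p : ℕ) : UU →ₗ[k] (symU k L p) :=
  (DirectSum.component k ℕ (fun p => symU k L p) p).comp
    (LinearEquiv.ofBijective (DirectSum.coeLinearMap (symU k L)) (internal' k L)).symm.toLinearMap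

theorem proj_same (p : ℕ) (s : symU k L p) : proj k L p s = s := by
  have : (LinearEquiv.ofBijective (DirectSum.coeLinearMap (symU k L)) (internal' k L)).symm s
      = DirectSum.lof k ℕ (fun p => symU k L p) p s := by
    rw [LinearEquiv.symm_apply_eq, LinearEquiv.ofBijective_apply, DirectSum.coeLinearMap_lof]
  simp only [proj, LinearMap.comp_apply, LinearEquiv.coe_coe, this]
  exact DirectSum.component.lof_self _ _ _

theorem proj_ne (p q : ℕ) (h : q ≠ p) (s : symU k L q) : proj k L p s = 0 := by
  have : (LinearEquiv.ofBijective (DirectSum.coeLinearMap (symU k L)) (internal' k L)).symm s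
      = DirectSum.lof k ℕ (fun p => symU k L p) q s := by
    rw [LinearEquiv.symm_apply_eq, LinearEquiv.ofBijective_apply, DirectSum.coeLinearMap_lof]
  simp only [proj, LinearMap.comp_apply, LinearEquiv.coe_coe, this]
  exact DirectSum.of_eq_of_ne _ _ _ h.symm

theorem one_mem : (1 : UU) ∈ symU k L 0 := by
  refine Submodule.subset_span ⟨Fin.elim0, ?_⟩
  simp

/-- retraction -/
def retr (p : {p : ℕ // 1 ≤ p}) : (UU ⧸ cyclicSub k L) →ₗ[k] (symU k L p.1 ⧸ commSym k L p.1) :=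
  Submodule.liftQ _ ((commSym k L p.1).mkQ.comp (proj k L p.1)) (by
    refine Submodule.span_le.mpr ?_
    rintro z (rfl | ⟨u, v, rfl⟩)
    · have := proj_ne k L p.1 0 (by have := p.2; lia) ⟨1, one_mem k L⟩
      simp only [SetLike.mem_coe, LinearMap.mem_ker, LinearMap.comp_apply]
      rw [this, map_zero]
    · refine comm_mem k L _ ?_ u v
      intro x u
      have hu : u ∈ ⨆ p, symU k L p := by rw [iSup_top]; trivial
      induction hu using Submodule.iSup_induction' with
      | mem q s hs =>
        rw [LinearMap.mem_ker, LinearMap.comp_apply]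
        by_cases hq : q = p.1
        · subst hq
          rw [proj_same k L p.1 ⟨_, ad_mem k L _ x s hs⟩]
          exact (Submodule.Quotient.mk_eq_zero _).mpr (Submodule.subset_span ⟨x, ⟨s, hs⟩, rfl⟩)
        · rw [proj_ne k L p.1 q hq ⟨_, ad_mem k L _ x s hs⟩, map_zero]
      | zero => simp
      | add a b _ _ h1 h2 =>
        have := add_mem h1 h2
        convert this using 1
        noncomm_ring)

theorem retr_toCyclic_same (p : {p : ℕ // 1 ≤ p}) (s) : retr k L p (toCyclic k L p.1 s) = s := by
  obtain ⟨s, rfl⟩ := Submodule.mkQ_surjective _ s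
  change (commSym k L p.1).mkQ (proj k L p.1 s) = _
  rw [proj_same]

theorem retr_toCyclic_ne (p q : {p : ℕ // 1 ≤ p}) (h : q ≠ p) (s) :
    retr k L p (toCyclic k L q.1 s) = 0 := by
  obtain ⟨s, rfl⟩ := Submodule.mkQ_surjective _ s
  change (commSym k L p.1).mkQ (proj k L p.1 s) = _
  rw [proj_ne k L p.1 q.1 (fun h' => h (Subtype.ext h')), map_zero]

theorem retr_total (p : {p : ℕ // 1 ≤ p})
    (d : DirectSum {p : ℕ // 1 ≤ p} fun p => symU k L p.1 ⧸ commSym k L p.1) :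
    retr k L p (DirectSum.toModule k {p : ℕ // 1 ≤ p} (UU ⧸ cyclicSub k L)
        (fun p => toCyclic k L p.1) d) = d p := by
  induction d using DirectSum.induction_on with
  | zero => simp
  | of q s =>
    have : DirectSum.toModule k {p : ℕ // 1 ≤ p} (UU ⧸ cyclicSub k L)
        (fun p => toCyclic k L p.1) (DirectSum.of _ q s) = toCyclic k L q.1 s :=
      DirectSum.toModule_lof (M := fun p : {p : ℕ // 1 ≤ p} => symU k L p.1 ⧸ commSym k L p.1) k q s
    rw [this]
    by_cases h : q = p
    · subst h
      rw [retr_toCyclic_same, DirectSum.of_eq_same]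
    · rw [retr_toCyclic_ne k L p q h, DirectSum.of_eq_of_ne _ _ _ (Ne.symm h)]
  | add a b h1 h2 => rw [map_add, map_add, h1, h2]; rfl

theorem main :
    Function.Bijective
      (DirectSum.toModule k {p : ℕ // 1 ≤ p}
        (UniversalEnvelopingAlgebra k L ⧸ cyclicSub k L)
        (fun p => toCyclic k L p.1)) := by
  constructor
  · intro a b h
    refine DFinsupp.ext fun p => ?_
    have := congrArg (retr k L p) h
    rwa [retr_total, retr_total] at this
  · rw [← LinearMap.range_eq_top, eq_top_iff]
    rintro y -
    obtain ⟨u, rfl⟩ := Submodule.mkQ_surjective _ y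
    have hu : u ∈ ⨆ p, symU k L p := by rw [iSup_top]; trivial
    induction hu using Submodule.iSup_induction' with
    | mem q s hs =>
      rcases Nat.eq_zero_or_pos q with rfl | hq
      · have h0 : symU k L 0 ≤ cyclicSub k L := symU_le k L 0 _ fun x => by
          rw [pow_zero]; exact Submodule.subset_span (Or.inl rfl)
        have : (cyclicSub k L).mkQ s = 0 := (Submodule.Quotient.mk_eq_zero _).mpr (h0 hs)
        rw [this]; exact zero_mem _
      · exact ⟨DirectSum.lof k {p : ℕ // 1 ≤ p} (fun p => symU k L p.1 ⧸ commSym k L p.1) ⟨q, hq⟩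
            ((commSym k L q).mkQ ⟨s, hs⟩),
          DirectSum.toModule_lof (M := fun p : {p : ℕ // 1 ≤ p} => symU k L p.1 ⧸ commSym k L p.1) k
            ⟨q, hq⟩ ((commSym k L q).mkQ ⟨s, hs⟩)⟩
    | zero => rw [map_zero]; exact zero_mem _
    | add a b _ _ h1 h2 => rw [map_add]; exact add_mem h1 h2

end CycAux

/-- For any Lie algebra `𝔞` over a field `k` of characteristic zero, the maps
induced by the inclusions `Sym^p(𝔞) ⊆ U𝔞` assemble to a `k`-linear isomorphism
`⊕_{p ≥ 1} Sym^p(𝔞)/[𝔞, Sym^p(𝔞)] ≅ U𝔞/(k·1 + [U𝔞, U𝔞])`. -/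
theorem statement1 :
    Function.Bijective
      (DirectSum.toModule k {p : ℕ // 1 ≤ p}
        (UniversalEnvelopingAlgebra k L ⧸ cyclicSub k L)
        (fun p => toCyclic k L p.1)) := by
  exact CycAux.main k L

end
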